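/- Let a, b, c, d be integers with a ≥ b and c ≥ d, and let ℓ ≥ 0. Among lattice paths from (a,b) to (c,d) with steps (1,0) and (0,1) all of whose points (x,y) satisfy x ≥ y: (i) the number of such paths with exactly ℓ NE-turns equals C(c−a, ℓ)·C(d−b, ℓ) − C(c−b−1, ℓ−1)·C(d−a+1, ℓ+1); and (ii) the number of such paths with exactly ℓ EN-turns equals C(c−a, ℓ)·C(d−b, ℓ) − C(c−b+1, ℓ)·C(d−a−1, ℓ). -/

import Mathlib

/-- The set of lattice paths (as lists of their points) from `A` to `E` in `ℤ²`
with steps `(1,0)` and `(0,1)`, all of whose points satisfy the condition `C`. -/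
def SPaths (A E : ℤ × ℤ) (C : ℤ × ℤ → Prop) : Set (List (ℤ × ℤ)) :=
  {p | p.head? = some A ∧ p.getLast? = some E ∧
       List.Chain' (fun q q' => q' - q = ((1 : ℤ), (0 : ℤ)) ∨ q' - q = ((0 : ℤ), (1 : ℤ))) p ∧
       ∀ q ∈ p, C q}

/-- Binomial coefficient `C(n,k)` for integer arguments, `0` unless `0 ≤ k ≤ n`. -/
def ibinom (n k : ℤ) : ℤ :=
  if 0 ≤ k ∧ k ≤ n then (Nat.choose n.toNat k.toNat : ℤ) else 0


/-- The number of NE-turns of a path, i.e. interior points reached by a step `(0,1)`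
and left by a step `(1,0)`. -/
def NEturns (p : List (ℤ × ℤ)) : ℕ :=
  ((Finset.range p.length).filter (fun j =>
    j + 2 < p.length ∧ p.getD (j + 1) 0 - p.getD j 0 = ((0 : ℤ), (1 : ℤ))
      ∧ p.getD (j + 2) 0 - p.getD (j + 1) 0 = ((1 : ℤ), (0 : ℤ)))).card

/-- The number of EN-turns of a path, i.e. interior points reached by a step `(1,0)`
and left by a step `(0,1)`. -/
def ENturns (p : List (ℤ × ℤ)) : ℕ :=
  ((Finset.range p.length).filter (fun j =>
    j + 2 < p.length ∧ p.getD (j + 1) 0 - p.getD j 0 = ((1 : ℤ), (0 : ℤ))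
      ∧ p.getD (j + 2) 0 - p.getD (j + 1) 0 = ((0 : ℤ), (1 : ℤ)))).card

/-- The number of interior points of `p` reached by a step `u` and left by a step `v`. -/
def turnCount (u v : ℤ × ℤ) (p : List (ℤ × ℤ)) : ℕ :=
  ((Finset.range p.length).filter (fun j =>
    j + 2 < p.length ∧ p.getD (j + 1) 0 - p.getD j 0 = u
      ∧ p.getD (j + 2) 0 - p.getD (j + 1) 0 = v)).card

lemma turnCount_singleton (u v x : ℤ × ℤ) : turnCount u v [x] = 0 := by
  simp [turnCount]

lemma turnCount_pair (u v x y : ℤ × ℤ) : turnCount u v [x, y] = 0 := by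
  simp [turnCount]

lemma turnCount_cons (u v x y z : ℤ × ℤ) (r : List (ℤ × ℤ)) :
    turnCount u v (x :: y :: z :: r) =
      (if y - x = u ∧ z - y = v then 1 else 0) + turnCount u v (y :: z :: r) := by
  unfold turnCount
  rw [Finset.card_filter, Finset.card_filter, List.length_cons, Finset.sum_range_succ', add_comm]
  congr 1
  · simp
  · refine Finset.sum_congr rfl fun j _ => ?_
    simp only [List.getD_cons_succ, List.length_cons]
    congr 1
    simp only [eq_iff_iff]
    refine and_congr ?_ Iff.rfl
    omega

lemma mem_SPaths_cons_cons (A B E : ℤ × ℤ) (C : ℤ × ℤ → Prop) (r : List (ℤ × ℤ)) :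
    A :: B :: r ∈ SPaths A E C ↔
      C A ∧ (B - A = (1, 0) ∨ B - A = (0, 1)) ∧ B :: r ∈ SPaths B E C := by
  simp only [SPaths, Set.mem_ofPred_eq, List.Chain', List.head?_cons, List.getLast?_cons_cons,
    List.isChain_cons_cons, List.forall_mem_cons]
  tauto

lemma mem_SPaths_singleton (A B E : ℤ × ℤ) (C : ℤ × ℤ → Prop) :
    [B] ∈ SPaths A E C ↔ B = A ∧ A = E ∧ C A := by
  simp only [SPaths, Set.mem_ofPred_eq, List.Chain', List.head?_cons, List.getLast?_singleton,
    List.isChain_singleton, Option.some.injEq, List.mem_singleton, forall_eq, true_and]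
  constructor
  · rintro ⟨rfl, rfl, h⟩; exact ⟨rfl, rfl, h⟩
  · rintro ⟨rfl, rfl, h⟩; exact ⟨rfl, rfl, h⟩

lemma exists_cons_of_mem_SPaths {A E : ℤ × ℤ} {C : ℤ × ℤ → Prop} {p : List (ℤ × ℤ)}
    (h : p ∈ SPaths A E C) : ∃ q, p = A :: q := by
  cases p with
  | nil => simp [SPaths] at h
  | cons x q =>
    have hx : x = A := by simpa using h.1
    exact ⟨q, by rw [hx]⟩

lemma le_of_mem_SPaths {A E : ℤ × ℤ} {C : ℤ × ℤ → Prop} {p : List (ℤ × ℤ)}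
    (h : p ∈ SPaths A E C) : A.1 ≤ E.1 ∧ A.2 ≤ E.2 := by
  induction p generalizing A with
  | nil => simp [SPaths] at h
  | cons x q ih =>
    obtain ⟨q', hq'⟩ := exists_cons_of_mem_SPaths h
    obtain ⟨rfl, rfl⟩ := List.cons.inj hq'
    cases q with
    | nil =>
      obtain ⟨-, rfl, -⟩ := (mem_SPaths_singleton _ _ _ _).1 h
      exact ⟨le_rfl, le_rfl⟩
    | cons B r =>
      obtain ⟨-, hs, hr⟩ := (mem_SPaths_cons_cons _ _ _ _ _).1 h
      have := ih hr
      rcases hs with hs | hs <;> rw [Prod.ext_iff] at hs <;> simp at hs <;> omega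

/-- The paths from `A` to `E` satisfying `C` which, when preceded by a step `w`, have exactly
`l` turns of type `u` followed by `v`. -/
def precededPaths (u v : ℤ × ℤ) (E : ℤ × ℤ) (C : ℤ × ℤ → Prop) (w A : ℤ × ℤ) (l : ℤ) :
    Set (List (ℤ × ℤ)) :=
  {p | p ∈ SPaths A E C ∧ (turnCount u v ((A - w) :: p) : ℤ) = l}

section Recursion

variable {u v : ℤ × ℤ} {E : ℤ × ℤ} {C : ℤ × ℤ → Prop}

lemma precededPaths_eq_empty {w A : ℤ × ℤ} {l : ℤ} (h : E.1 < A.1 ∨ E.2 < A.2) :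
    precededPaths u v E C w A l = ∅ := by
  ext p
  simp only [Set.mem_empty_iff_false, iff_false]
  intro hp
  have := le_of_mem_SPaths hp.1
  omega

lemma precededPaths_eq_empty_of_not {w A : ℤ × ℤ} {l : ℤ} (h : ¬ C A) :
    precededPaths u v E C w A l = ∅ := by
  ext p
  simp only [Set.mem_empty_iff_false, iff_false]
  rintro ⟨hp, -⟩
  obtain ⟨q, rfl⟩ := exists_cons_of_mem_SPaths hp
  exact h (hp.2.2.2 A (by simp))

lemma precededPaths_second (huv : u ≠ v) (A : ℤ × ℤ) (l : ℤ) :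
    precededPaths u v E C v A l = {p | p ∈ SPaths A E C ∧ (turnCount u v p : ℤ) = l} := by
  ext p
  simp only [precededPaths, Set.mem_ofPred_eq]
  refine and_congr_right fun hp => ?_
  obtain ⟨q, rfl⟩ := exists_cons_of_mem_SPaths hp
  cases q with
  | nil => rw [turnCount_pair, turnCount_singleton]
  | cons B r =>
    rw [turnCount_cons, if_neg, zero_add]
    rintro ⟨h, -⟩
    exact huv (by rw [← h]; abel)

lemma precededPaths_eq_union (huv : u ≠ v)
    (hsteps : ∀ s : ℤ × ℤ, (s = (1, 0) ∨ s = (0, 1)) ↔ (s = u ∨ s = v))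
    {w A : ℤ × ℤ} (l : ℤ) (hA : C A) :
    precededPaths u v E C w A l =
      ({p | p = [A] ∧ A = E ∧ l = 0} ∪
        List.cons A '' precededPaths u v E C u (A + u) l) ∪
        List.cons A '' precededPaths u v E C v (A + v) (l - if w = u then 1 else 0) := by
  ext p
  simp only [Set.mem_union, Set.mem_image]
  constructor
  · rintro ⟨hp, hl⟩
    obtain ⟨q, rfl⟩ := exists_cons_of_mem_SPaths hp
    cases q with
    | nil =>
      obtain ⟨-, hE, -⟩ := (mem_SPaths_singleton _ _ _ _).1 hp
      rw [turnCount_pair] at hl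
      exact Or.inl (Or.inl ⟨rfl, hE, by simpa using hl.symm⟩)
    | cons B r =>
      obtain ⟨-, hs, hr⟩ := (mem_SPaths_cons_cons _ _ _ _ _).1 hp
      rw [hsteps] at hs
      rw [turnCount_cons, sub_sub_cancel] at hl
      rcases hs with hs | hs
      · have hB : B = A + u := by rw [← hs]; abel
        subst hB
        refine Or.inl (Or.inr ⟨_, ⟨hr, ?_⟩, rfl⟩)
        rw [add_sub_cancel_right, ← hl]
        simp [huv]
      · have hB : B = A + v := by rw [← hs]; abel
        subst hB
        refine Or.inr ⟨_, ⟨hr, ?_⟩, rfl⟩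
        rw [add_sub_cancel_right, ← hl]
        simp
  · rintro ((⟨rfl, rfl, rfl⟩ | ⟨q, ⟨hq, hl⟩, rfl⟩) | ⟨q, ⟨hq, hl⟩, rfl⟩)
    · exact ⟨(mem_SPaths_singleton _ _ _ _).2 ⟨rfl, rfl, hA⟩, by rw [turnCount_pair]; rfl⟩
    · obtain ⟨r, rfl⟩ := exists_cons_of_mem_SPaths hq
      refine ⟨(mem_SPaths_cons_cons _ _ _ _ _).2 ⟨hA, (hsteps _).2 (Or.inl ?_), hq⟩, ?_⟩
      · abel
      · rw [add_sub_cancel_right] at hl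
        rw [turnCount_cons, ← hl]
        simp [huv]
    · obtain ⟨r, rfl⟩ := exists_cons_of_mem_SPaths hq
      refine ⟨(mem_SPaths_cons_cons _ _ _ _ _).2 ⟨hA, (hsteps _).2 (Or.inr ?_), hq⟩, ?_⟩
      · abel
      · rw [add_sub_cancel_right] at hl
        rw [turnCount_cons]
        push_cast
        rw [hl]
        simp

lemma precededPaths_finite (huv : u ≠ v)
    (hsteps : ∀ s : ℤ × ℤ, (s = (1, 0) ∨ s = (0, 1)) ↔ (s = u ∨ s = v))
    (w A : ℤ × ℤ) (l : ℤ) : (precededPaths u v E C w A l).Finite := by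
  obtain ⟨n, hn⟩ : ∃ n : ℕ, E.1 - A.1 + (E.2 - A.2) < n :=
    ⟨(E.1 - A.1 + (E.2 - A.2)).toNat + 1, by omega⟩
  induction n generalizing w A l with
  | zero =>
    rw [precededPaths_eq_empty (by push_cast at hn; omega)]
    exact Set.finite_empty
  | succ n ih =>
    by_cases hA : C A
    · have hstep : ∀ s : ℤ × ℤ, (s = u ∨ s = v) →
          E.1 - (A + s).1 + (E.2 - (A + s).2) < n := by
        intro s hs
        push_cast at hn
        rcases (hsteps s).2 hs with rfl | rfl <;> simp <;> omega
      rw [precededPaths_eq_union huv hsteps l hA]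
      refine Set.Finite.union (Set.Finite.union ?_ ?_) ?_
      · exact (Set.finite_singleton [A]).subset fun p hp => hp.1
      · exact (ih _ _ _ (hstep u (Or.inl rfl))).image _
      · exact (ih _ _ _ (hstep v (Or.inr rfl))).image _
    · rw [precededPaths_eq_empty_of_not hA]
      exact Set.finite_empty

lemma ncard_precededPaths (huv : u ≠ v)
    (hsteps : ∀ s : ℤ × ℤ, (s = (1, 0) ∨ s = (0, 1)) ↔ (s = u ∨ s = v))
    {w A : ℤ × ℤ} (l : ℤ) (hA : C A) :
    (precededPaths u v E C w A l).ncard = (if A = E ∧ l = 0 then 1 else 0) +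
      (precededPaths u v E C u (A + u) l).ncard +
      (precededPaths u v E C v (A + v) (l - if w = u then 1 else 0)).ncard := by
  have hfin := precededPaths_finite (E := E) (C := C) huv hsteps
  have hsing : {p : List (ℤ × ℤ) | p = [A] ∧ A = E ∧ l = 0}.Finite :=
    (Set.finite_singleton [A]).subset fun p hp => hp.1
  rw [precededPaths_eq_union huv hsteps l hA, Set.ncard_union_eq _
    (hsing.union ((hfin _ _ _).image _)) ((hfin _ _ _).image _),
    Set.ncard_union_eq _ hsing ((hfin _ _ _).image _),
    Set.ncard_image_of_injective _ List.cons_injective,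
    Set.ncard_image_of_injective _ List.cons_injective]
  · congr 2
    split_ifs with h
    · simp [h]
    · simp [h]
  · rw [Set.disjoint_left]
    rintro p ⟨rfl, -⟩ ⟨q, ⟨hq, -⟩, h⟩
    obtain ⟨r, rfl⟩ := exists_cons_of_mem_SPaths hq
    simp at h
  · rw [Set.disjoint_left]
    rintro p (⟨rfl, -⟩ | ⟨q', ⟨hq', -⟩, rfl⟩) ⟨q, ⟨hq, -⟩, h⟩
    · obtain ⟨r, rfl⟩ := exists_cons_of_mem_SPaths hq
      simp at h
    · obtain ⟨r, rfl⟩ := exists_cons_of_mem_SPaths hq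
      obtain ⟨r', rfl⟩ := exists_cons_of_mem_SPaths hq'
      simp only [List.cons.injEq, add_right_inj, true_and] at h
      exact huv h.1.symm

end Recursion

lemma ibinom_of_neg_left {n : ℤ} (k : ℤ) (h : n < 0) : ibinom n k = 0 :=
  if_neg (by omega)

lemma ibinom_of_neg_right (n : ℤ) {k : ℤ} (h : k < 0) : ibinom n k = 0 :=
  if_neg (by omega)

lemma ibinom_of_lt {n k : ℤ} (h : n < k) : ibinom n k = 0 :=
  if_neg (by omega)

lemma ibinom_mul_ibinom_eq_zero {n k m j : ℤ} (h : ¬ ((0 ≤ k ∧ k ≤ n) ∧ 0 ≤ j ∧ j ≤ m)) :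
    ibinom n k * ibinom m j = 0 := by
  unfold ibinom
  split_ifs with h1 h2
  · exact absurd ⟨h1, h2⟩ h
  · simp
  · simp
  · simp

lemma ibinom_zero_right {n : ℤ} (h : 0 ≤ n) : ibinom n 0 = 1 := by
  simp [ibinom, h]

lemma ibinom_pascal {n k : ℤ} (h : n ≠ 0 ∨ k ≠ 0) :
    ibinom n k = ibinom (n - 1) k + ibinom (n - 1) (k - 1) := by
  rcases lt_or_ge n 0 with hn | hn
  · simp [ibinom_of_neg_left, hn, show n - 1 < 0 by omega]
  rcases lt_trichotomy k 0 with hk | rfl | hk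
  · simp [ibinom_of_neg_right, hk, show k - 1 < 0 by omega]
  · rw [ibinom_zero_right hn, ibinom_zero_right (by omega), ibinom_of_neg_right _ (by omega)]
    rfl
  · rcases lt_or_ge n k with hnk | hnk
    · simp [ibinom_of_lt, hnk, show n - 1 < k by omega]
    · lift n to ℕ using hn
      lift k to ℕ using hk.le
      obtain ⟨m, rfl⟩ : ∃ m, n = m + 1 := ⟨n - 1, by omega⟩
      obtain ⟨j, rfl⟩ : ∃ j, k = j + 1 := ⟨k - 1, by omega⟩
      have h1 : ∀ i : ℕ, ibinom (m : ℤ) (i : ℤ) = (m.choose i : ℤ) := by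
        intro i
        unfold ibinom
        split_ifs with hi
        · simp
        · rw [Nat.choose_eq_zero_of_lt (by omega)]; rfl
      have h2 : ibinom ((m + 1 : ℕ) : ℤ) ((j + 1 : ℕ) : ℤ) = ((m + 1).choose (j + 1) : ℤ) := by
        unfold ibinom
        rw [if_pos ⟨by omega, hnk⟩]
        simp only [Int.toNat_natCast]
      rw [h2, Nat.choose_succ_succ]
      have e1 : ((m + 1 : ℕ) : ℤ) - 1 = m := by push_cast; ring
      have e2 : ((j + 1 : ℕ) : ℤ) - 1 = j := by push_cast; ring
      rw [e1, e2, h1, h1]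
      push_cast
      ring

/-- Counts of lattice paths weakly below the diagonal with respect to their NE-turns, when
preceded by a horizontal step, respectively (for `a < c` and `a = c`) by a vertical step. -/
lemma ncard_precededPaths_NE (c d : ℤ) (hcd : d ≤ c) (a b l : ℤ) :
    (b ≤ a → ((precededPaths (0, 1) (1, 0) (c, d) (fun q => q.2 ≤ q.1)
        (1, 0) (a, b) l).ncard : ℤ) =
      ibinom (c - a) l * ibinom (d - b) l
        - ibinom (c - b - 1) (l - 1) * ibinom (d - a + 1) (l + 1)) ∧
    (b ≤ a + 1 → a < c → ((precededPaths (0, 1) (1, 0) (c, d) (fun q => q.2 ≤ q.1)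
        (0, 1) (a, b) l).ncard : ℤ) =
      ibinom (c - a - 1) (l - 1) * ibinom (d - b + 1) l
        - ibinom (c - b) (l - 1) * ibinom (d - a) l) ∧
    (b ≤ a + 1 → a = c → ((precededPaths (0, 1) (1, 0) (c, d) (fun q => q.2 ≤ q.1)
        (0, 1) (a, b) l).ncard : ℤ) = if b ≤ d ∧ l = 0 then 1 else 0) := by
  have huv : ((0, 1) : ℤ × ℤ) ≠ (1, 0) := by decide
  have hsteps : ∀ s : ℤ × ℤ, (s = (1, 0) ∨ s = (0, 1)) ↔ (s = (0, 1) ∨ s = (1, 0)) :=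
    fun s => or_comm
  induction hm : (c - a + (d - b) + 1).toNat using Nat.strong_induction_on generalizing a b l with
  | _ m ih =>
  by_cases hE : c < a ∨ d < b
  · simp only [precededPaths_eq_empty (E := (c, d)) (A := (a, b)) hE, Set.ncard_empty,
      Nat.cast_zero]
    refine ⟨fun h => ?_, fun h h' => ?_, fun h h' => ?_⟩
    · rw [ibinom_mul_ibinom_eq_zero (by omega), ibinom_mul_ibinom_eq_zero (by omega), sub_zero]
    · rw [ibinom_mul_ibinom_eq_zero (by omega), ibinom_mul_ibinom_eq_zero (by omega), sub_zero]
    · rw [if_neg (by omega)]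
  by_cases hba : b ≤ a
  · have hN := fun l => ih _ (by omega) a (b + 1) l rfl
    have hE' := fun l => (ih _ (by omega) (a + 1) b l rfl).1 (by omega)
    have hrec := fun w => ncard_precededPaths (E := (c, d)) (C := fun q => q.2 ≤ q.1)
      (A := (a, b)) (w := w) huv hsteps l hba
    simp only [Prod.mk_add_mk, add_zero, Prod.mk.injEq] at hrec
    have hrec1 := hrec (1, 0)
    have hrec2 := hrec (0, 1)
    rw [if_neg huv.symm, sub_zero] at hrec1
    rw [if_pos (Eq.refl ((0, 1) : ℤ × ℤ))] at hrec2
    rw [hrec1, hrec2]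
    push_cast
    have hN2 := fun l => (hN l).2.1 (by omega)
    have hN3 := fun l => (hN l).2.2 (by omega)
    refine ⟨fun _ => ?_, fun _ hac => ?_, fun _ hac => ?_⟩
    · rw [hE']
      rcases lt_or_ge a c with hac | hac
      · rw [hN2 _ hac, if_neg (by omega), ibinom_pascal (n := c - a) (k := l) (by omega)]
        have h1 : ibinom (c - b - 1) (l - 1) * ibinom (d - a + 1) (l + 1) =
            ibinom (c - b - 1) (l - 1) * (ibinom (d - a) (l + 1) + ibinom (d - a) l) := by
          by_cases hl : l + 1 = 0
          · rw [ibinom_of_neg_right _ (by omega : l - 1 < 0), zero_mul, zero_mul]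
          · rw [ibinom_pascal (Or.inr hl), add_sub_cancel_right, add_sub_cancel_right]
        rw [h1, show c - (a + 1) = c - a - 1 by ring, show d - (b + 1) + 1 = d - b by ring,
          show d - (a + 1) + 1 = d - a by ring, show c - (b + 1) = c - b - 1 by ring]
        ring
      · obtain rfl : a = c := by omega
        rw [hN3 _ rfl, ibinom_of_neg_left _ (by omega : a - (a + 1) < 0), zero_mul,
          ibinom_mul_ibinom_eq_zero (m := d - (a + 1) + 1) (by omega),
          ibinom_mul_ibinom_eq_zero (m := d - a + 1) (by omega)]
        by_cases hl : l = 0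
        · subst hl
          rw [ibinom_zero_right (by omega), ibinom_zero_right (by omega)]
          split_ifs <;> omega
        · rw [if_neg (by omega), if_neg (by omega), ibinom_mul_ibinom_eq_zero (by omega)]
          rfl
    · rw [hE', hN2 _ hac, if_neg (by omega), ibinom_pascal (n := d - b + 1) (k := l) (by omega),
        ibinom_pascal (n := c - b) (k := l - 1) (by omega)]
      rw [show c - (a + 1) = c - a - 1 by ring, show d - (b + 1) + 1 = d - b by ring,
        show d - (a + 1) + 1 = d - a by ring, show c - (b + 1) = c - b - 1 by ring,
        add_sub_cancel_right, sub_add_cancel]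
      ring
    · rw [hE', hN3 _ hac, ibinom_of_neg_left _ (by omega : c - (a + 1) < 0), zero_mul,
        ibinom_mul_ibinom_eq_zero (by omega)]
      split_ifs <;> omega
  · simp only [precededPaths_eq_empty_of_not (A := (a, b)) (C := fun q => q.2 ≤ q.1) hba,
      Set.ncard_empty, Nat.cast_zero]
    refine ⟨fun h => absurd h hba, fun h h' => ?_, fun h h' => ?_⟩
    · obtain rfl : b = a + 1 := by omega
      ring_nf
    · rw [if_neg (by omega)]

/-- Counts of lattice paths weakly below the diagonal with respect to their EN-turns, when
preceded by a vertical step, respectively (for `b < d` and `b = d`) by a horizontal step. -/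
lemma ncard_precededPaths_EN (c d : ℤ) (hcd : d ≤ c) (a b l : ℤ) :
    (b ≤ a + 1 → ((precededPaths (1, 0) (0, 1) (c, d) (fun q => q.2 ≤ q.1)
        (0, 1) (a, b) l).ncard : ℤ) =
      ibinom (c - a) l * ibinom (d - b) l
        - ibinom (c - b + 1) l * ibinom (d - a - 1) l) ∧
    (b ≤ a → b < d → ((precededPaths (1, 0) (0, 1) (c, d) (fun q => q.2 ≤ q.1)
        (1, 0) (a, b) l).ncard : ℤ) =
      ibinom (d - b - 1) (l - 1) * ibinom (c - a + 1) l
        - ibinom (c - b) (l - 1) * ibinom (d - a) l) ∧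
    (b ≤ a → b = d → ((precededPaths (1, 0) (0, 1) (c, d) (fun q => q.2 ≤ q.1)
        (1, 0) (a, b) l).ncard : ℤ) = if a ≤ c ∧ l = 0 then 1 else 0) := by
  have huv : ((1, 0) : ℤ × ℤ) ≠ (0, 1) := by decide
  have hsteps : ∀ s : ℤ × ℤ, (s = (1, 0) ∨ s = (0, 1)) ↔ (s = (1, 0) ∨ s = (0, 1)) :=
    fun s => Iff.rfl
  induction hm : (c - a + (d - b) + 1).toNat using Nat.strong_induction_on generalizing a b l with
  | _ m ih =>
  by_cases hE : c < a ∨ d < b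
  · simp only [precededPaths_eq_empty (E := (c, d)) (A := (a, b)) hE, Set.ncard_empty,
      Nat.cast_zero]
    refine ⟨fun h => ?_, fun h h' => ?_, fun h h' => ?_⟩
    · rw [ibinom_mul_ibinom_eq_zero (by omega), ibinom_mul_ibinom_eq_zero (by omega), sub_zero]
    · rw [ibinom_mul_ibinom_eq_zero (by omega), ibinom_mul_ibinom_eq_zero (by omega), sub_zero]
    · rw [if_neg (by omega)]
  by_cases hba : b ≤ a
  · have hE' := (ih _ (by omega) (a + 1) b l rfl).2
    have hN := fun l => (ih _ (by omega) a (b + 1) l rfl).1 (by omega)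
    have hrec := fun w => ncard_precededPaths (E := (c, d)) (C := fun q => q.2 ≤ q.1)
      (A := (a, b)) (w := w) huv hsteps l hba
    simp only [Prod.mk_add_mk, add_zero, Prod.mk.injEq] at hrec
    have hrec1 := hrec (0, 1)
    have hrec2 := hrec (1, 0)
    rw [if_neg huv.symm, sub_zero] at hrec1
    rw [if_pos (Eq.refl ((1, 0) : ℤ × ℤ))] at hrec2
    rw [hrec1, hrec2]
    push_cast
    have hE2 := hE'.1 (by omega)
    have hE3 := hE'.2 (by omega)
    refine ⟨fun _ => ?_, fun _ hbd => ?_, fun _ hbd => ?_⟩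
    · rw [hN]
      rcases lt_or_ge b d with hbd | hbd
      · rw [hE2 hbd, if_neg (by omega), ibinom_pascal (n := d - b) (k := l) (by omega),
          ibinom_pascal (n := c - b + 1) (k := l) (by omega)]
        rw [show c - (a + 1) + 1 = c - a by ring, show d - (b + 1) = d - b - 1 by ring,
          show d - (a + 1) = d - a - 1 by ring, show c - (b + 1) + 1 = c - b by ring,
          add_sub_cancel_right]
        ring
      · obtain rfl : b = d := by omega
        rw [hE3 rfl, ibinom_mul_ibinom_eq_zero (by omega), ibinom_mul_ibinom_eq_zero (by omega),
          ibinom_mul_ibinom_eq_zero (n := c - b + 1) (by omega)]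
        by_cases hl : l = 0
        · subst hl
          rw [ibinom_zero_right (by omega), ibinom_zero_right (by omega)]
          split_ifs <;> omega
        · rw [if_neg (by omega), if_neg (by omega), ibinom_mul_ibinom_eq_zero (by omega)]
          rfl
    · have h1 : ibinom (c - b) (l - 1) * ibinom (d - a) l =
          ibinom (c - b) (l - 1) * (ibinom (d - a - 1) l + ibinom (d - a - 1) (l - 1)) := by
        by_cases hl : l = 0
        · rw [ibinom_of_neg_right _ (by omega : l - 1 < 0), zero_mul, zero_mul]
        · rw [← ibinom_pascal (Or.inr hl)]
      rw [hN, hE2 hbd, if_neg (by omega), h1,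
        ibinom_pascal (n := c - a + 1) (k := l) (by omega)]
      rw [show c - (a + 1) + 1 = c - a by ring, show d - (b + 1) = d - b - 1 by ring,
        show d - (a + 1) = d - a - 1 by ring, show c - (b + 1) + 1 = c - b by ring,
        add_sub_cancel_right]
      ring
    · rw [hN, hE3 hbd, ibinom_mul_ibinom_eq_zero (by omega), ibinom_mul_ibinom_eq_zero (by omega)]
      split_ifs <;> omega
  · simp only [precededPaths_eq_empty_of_not (A := (a, b)) (C := fun q => q.2 ≤ q.1) hba,
      Set.ncard_empty, Nat.cast_zero]
    refine ⟨fun h => ?_, fun h => absurd h hba, fun h => absurd h hba⟩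
    obtain rfl : b = a + 1 := by omega
    ring_nf

theorem statement10 (a b c d : ℤ) (hab : b ≤ a) (hcd : d ≤ c) (ℓ : ℕ) :
    (({p | p ∈ SPaths (a, b) (c, d) (fun q => q.2 ≤ q.1) ∧ NEturns p = ℓ} :
          Set (List (ℤ × ℤ))).ncard : ℤ)
        = ibinom (c - a) (ℓ : ℤ) * ibinom (d - b) (ℓ : ℤ)
          - ibinom (c - b - 1) ((ℓ : ℤ) - 1) * ibinom (d - a + 1) ((ℓ : ℤ) + 1)
    ∧ (({p | p ∈ SPaths (a, b) (c, d) (fun q => q.2 ≤ q.1) ∧ ENturns p = ℓ} :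
          Set (List (ℤ × ℤ))).ncard : ℤ)
        = ibinom (c - a) (ℓ : ℤ) * ibinom (d - b) (ℓ : ℤ)
          - ibinom (c - b + 1) (ℓ : ℤ) * ibinom (d - a - 1) (ℓ : ℤ) := by
  have hNE := (ncard_precededPaths_NE c d hcd a b ℓ).1 hab
  have hEN := (ncard_precededPaths_EN c d hcd a b ℓ).1 (by omega)
  rw [precededPaths_second (by decide)] at hNE hEN
  simp only [Nat.cast_inj] at hNE hEN
  exact ⟨hNE, hEN⟩
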